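/- Suppose f_n = f_{n−1}·h and f_{n−2} = f_{n−3}·h for a linear form h = px + qy (p,q ≠ 0) and binary forms f_{n−1}, f_{n−3} of degrees n−1 and n−3. Then res(f_n, x∂_x f_n + t x y f_{n−2}) = (−1)^{n−1} p q · res(h, f_{n−1})² · res(f_{n−1}, x∂_x f_{n−1} + t x y f_{n−3}). -/

import Mathlib

open Polynomial Finset

/-- The resultant of two binary forms of (formal) degrees `d` and `e`, given by their
dehomogenizations. -/
noncomputable def res {k : Type*} [CommRing k] (d e : ℕ) (p q : Polynomial k) : k :=
  (-1 : k) ^ (d * e) *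
    Matrix.det (Matrix.of fun i j : Fin (d + e) =>
      if (i : ℕ) < e then
        (if (i : ℕ) ≤ (j : ℕ) ∧ (j : ℕ) ≤ d + (i : ℕ) then
          p.coeff (d + (i : ℕ) - (j : ℕ)) else 0)
      else
        (if (i : ℕ) - e ≤ (j : ℕ) ∧ (j : ℕ) ≤ (i : ℕ) then
          q.coeff ((i : ℕ) - (j : ℕ)) else 0))

/-- The bracket `[u,v] = u₀v₁ - v₀u₁`. -/
def bracket {k : Type*} [CommRing k] (u v : Fin 2 → k) : k := u 0 * v 1 - v 0 * u 1

/-- The numerator of the discriminant-resultant generating polynomial: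
`res(f_n, x ∂ₓ f_n + t·x·y·f_{n-2})`, computed over `k[t]`. -/
noncomputable def DRnum {k : Type*} [CommRing k] (n : ℕ) (p q : Polynomial k) :
    Polynomial k :=
  res n n (p.map (Polynomial.C : k →+* Polynomial k))
    (Polynomial.X * (Polynomial.derivative p).map (Polynomial.C : k →+* Polynomial k) +
      Polynomial.C (Polynomial.X : Polynomial k) * Polynomial.X *
        (q.map (Polynomial.C : k →+* Polynomial k)))

/-- The `r`-th discriminant-resultant `DR_{n,r}`: the coefficient of `t^r` in
`res(f_n, x ∂ₓ f_n + t·x·y·f_{n-2}) / (a₀ aₙ)`. -/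
noncomputable def DR {k : Type*} [Field k] (n r : ℕ) (p q : Polynomial k) : k :=
  (DRnum n p q).coeff r / (p.coeff 0 * p.coeff n)

namespace Polynomial

variable {R : Type*} [CommRing R]

/-- Multiplicativity of the resultant in the second argument, for formal degrees. -/
lemma resultant_mul_right_of_natDegree_le (f g₁ g₂ : R[X]) {m a b : ℕ} (hf : f.natDegree ≤ m)
    (h₁ : g₁.natDegree ≤ a) (h₂ : g₂.natDegree ≤ b) :
    resultant f (g₁ * g₂) m (a + b) = resultant f g₁ m a * resultant f g₂ m b := by
  obtain ⟨c, rfl⟩ := Nat.exists_eq_add_of_le h₁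
  obtain ⟨d, rfl⟩ := Nat.exists_eq_add_of_le h₂
  rw [show g₁.natDegree + c + (g₂.natDegree + d) = g₁.natDegree + g₂.natDegree + (c + d) by ring,
    resultant_add_right_deg _ _ _ _ _ natDegree_mul_le, resultant_add_right_deg _ _ _ _ _ le_rfl,
    resultant_add_right_deg _ _ _ _ _ le_rfl, resultant_mul_right _ _ _ _ hf]
  ring

/-- Multiplicativity of the resultant in the first argument, for formal degrees. -/
lemma resultant_mul_left_of_natDegree_le (f₁ f₂ g : R[X]) {a b n : ℕ} (hg : g.natDegree ≤ n)
    (h₁ : f₁.natDegree ≤ a) (h₂ : f₂.natDegree ≤ b) :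
    resultant (f₁ * f₂) g (a + b) n = resultant f₁ g a n * resultant f₂ g b n := by
  rw [resultant_comm, resultant_mul_right_of_natDegree_le _ _ _ hg h₁ h₂, resultant_comm f₁,
    resultant_comm f₂, add_mul, pow_add, mul_comm a n, mul_comm b n]
  ring

/-- The resultant of the linear form `uX + v` with `X`. -/
lemma resultant_linear_X (u v : R) : resultant (C u * X + C v) X 1 1 = -v := by
  simp [resultant, sylvester, Matrix.det_fin_two, Fin.addCases]

/-- The resultant of `f * h` with `h * A + X * (u * f)`, where `h = uX + v`. -/
lemma resultant_mul_linear (f A : R[X]) (u v : R) {m : ℕ} (hf : f.natDegree ≤ m)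
    (hA : A.natDegree ≤ m) :
    resultant (f * (C u * X + C v)) ((C u * X + C v) * A + f * (C u * X)) (m + 1) (m + 1) =
      (-1) ^ (m + 1) * u * v * resultant (C u * X + C v) f 1 m ^ 2 * resultant f A m m := by
  have hh : (C u * X + C v).natDegree ≤ 1 := natDegree_linear_le
  have hX : (C u * X).natDegree ≤ 1 := (natDegree_C_mul_le _ _).trans natDegree_X_le
  have hG : ((C u * X + C v) * A + f * (C u * X)).natDegree ≤ m + 1 :=
    natDegree_add_le_of_degree_le
      ((natDegree_mul_le_of_le hh hA).trans_eq (add_comm _ _)) (natDegree_mul_le_of_le hf hX)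
  have hleft : resultant f ((C u * X + C v) * A + f * (C u * X)) m (m + 1) =
      (-1) ^ m * resultant (C u * X + C v) f 1 m * resultant f A m m := by
    rw [resultant_add_mul_right _ _ _ _ _ (by lia) hf, add_comm m 1,
      resultant_mul_right_of_natDegree_le _ _ _ hf hh hA, resultant_comm f, mul_one]
  have hright : resultant (C u * X + C v) ((C u * X + C v) * A + f * (C u * X)) 1 (m + 1) =
      -(u * v * resultant (C u * X + C v) f 1 m) := by
    rw [add_comm (_ * A), resultant_add_mul_right _ _ _ _ _ (by lia) hh,
      show f * (C u * X) = C u * (f * X) by ring, resultant_C_mul_right,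
      resultant_mul_right_of_natDegree_le _ _ _ hh hf natDegree_X_le, resultant_linear_X]
    ring
  rw [resultant_mul_left_of_natDegree_le _ _ _ hG hf hh, hleft, hright]
  ring

end Polynomial

lemma neg_one_pow_mul_self {R : Type*} [CommRing R] (a : ℕ) : (-1 : R) ^ (a * a) = (-1) ^ a := by
  rcases Nat.even_or_odd a with ha | ha
  · rw [ha.neg_one_pow, (ha.mul_left a).neg_one_pow]
  · rw [ha.neg_one_pow, (ha.mul ha).neg_one_pow]

/-- `res` agrees with Mathlib's resultant up to sign. -/
lemma res_eq_resultant {R : Type*} [CommRing R] (d e : ℕ) (p q : Polynomial R) :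
    res d e p q = (-1) ^ (d * e) * resultant p q d e := by
  rw [res, resultant, ← Matrix.det_transpose (sylvester p q d e),
    ← Matrix.det_submatrix_equiv_self Fin.revPerm (sylvester p q d e).transpose]
  congr 2
  ext i j
  obtain ⟨i, rfl⟩ := Fin.revPerm.surjective i
  induction i using Fin.addCases with
  | left i =>
    have hi : ¬ d + e - (i + 1) < e := by lia
    simp only [Matrix.of_apply, Matrix.submatrix_apply, Matrix.transpose_apply, sylvester,
      Fin.revPerm_apply, Fin.rev_rev, Fin.addCases_left, Fin.val_rev, Fin.val_castAdd,
      Set.mem_Icc, hi, if_false]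
    split_ifs <;> first | rfl | (congr 1; lia)
  | right i =>
    have hi : d + e - (d + i + 1) < e := by lia
    simp only [Matrix.of_apply, Matrix.submatrix_apply, Matrix.transpose_apply, sylvester,
      Fin.revPerm_apply, Fin.rev_rev, Fin.addCases_right, Fin.val_rev, Fin.val_natAdd,
      Set.mem_Icc, hi, if_true]
    split_ifs <;> first | rfl | (congr 1; lia)

/-- If `f_n = f_{n-1}·h` and `f_{n-2} = f_{n-3}·h` for a linear form `h = px + qy`
(`p, q ≠ 0`), then
`res(f_n, x∂ₓf_n + t·x·y·f_{n-2}) = (-1)^{n-1} p q · res(h, f_{n-1})² · res(f_{n-1}, x∂ₓf_{n-1} + t·x·y·f_{n-3})`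
as polynomials in `t`. -/
theorem res_common_factor {k : Type*} [Field k] [CharZero k] (n : ℕ) (hn : 3 ≤ n)
    (u v : k) (hu : u ≠ 0) (hv : v ≠ 0) (h f g : Polynomial k)
    (hh : h = C u * X + C v) (hf : f.natDegree ≤ n - 1) (hg : g.natDegree ≤ n - 3) :
    DRnum n (f * h) (g * h) =
      Polynomial.C ((-1 : k) ^ (n - 1) * u * v * (res 1 (n - 1) h f) ^ 2) *
        DRnum (n - 1) f g := by
  subst hh
  obtain ⟨m, rfl⟩ : ∃ m, n = m + 1 := ⟨n - 1, by lia⟩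
  simp only [Nat.add_sub_cancel] at hf ⊢
  set A : Polynomial (Polynomial k) := X * (derivative f).map C + C X * X * g.map C with hA_def
  have hf' : (f.map (C : k →+* Polynomial k)).natDegree ≤ m := natDegree_map_le.trans hf
  have hA : A.natDegree ≤ m := by
    refine natDegree_add_le_of_degree_le ?_ ?_
    · have hd : ((derivative f).map (C : k →+* Polynomial k)).natDegree ≤ m - 1 :=
        natDegree_map_le.trans ((natDegree_derivative_le f).trans (by lia))
      exact (natDegree_mul_le_of_le natDegree_X_le hd).trans (by lia)
    · have hd : (g.map (C : k →+* Polynomial k)).natDegree ≤ m - 2 :=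
        natDegree_map_le.trans (by lia)
      exact (natDegree_mul_le_of_le ((natDegree_C_mul_le _ _).trans natDegree_X_le) hd).trans (by lia)
  have hlin : (C u * X + C v : Polynomial k).map (C : k →+* Polynomial k) =
      C (C u) * X + C (C v) := by simp
  have hG : X * (derivative (f * (C u * X + C v))).map (C : k →+* Polynomial k) +
      C X * X * (g * (C u * X + C v)).map C =
      (C (C u) * X + C (C v)) * A + f.map C * (C (C u) * X) := by
    simp only [hA_def, derivative_mul, derivative_add, derivative_C, derivative_X,
      Polynomial.map_add, Polynomial.map_mul, map_C, map_X, Polynomial.map_zero,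
      Polynomial.map_one]
    ring
  have hsq : ((-1 : Polynomial k) ^ m) ^ 2 = 1 := by rw [← pow_mul, mul_comm, pow_mul]; simp
  rw [DRnum, DRnum, hG, Polynomial.map_mul, hlin, ← hA_def, res_eq_resultant, res_eq_resultant,
    res_eq_resultant, neg_one_pow_mul_self, neg_one_pow_mul_self,
    resultant_mul_linear _ _ _ _ hf' hA, ← hlin, resultant_map_map]
  simp only [map_mul, map_pow, map_neg, map_one, one_mul]
  linear_combination (-(C u * C v * C ((C u * X + C v).resultant f 1 m) ^ 2 *
    (f.map C).resultant A m m * ((-1) ^ m) ^ 2)) * hsq
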